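/- For every permutation σ of [n], the descent–plateau polynomial of nonnesting permutations whose first-copy subsequence equals σ satisfies C_n^σ(t,u) = t^{des(σ)} · N_n(t,u). -/

import Mathlib

attribute [local instance] Classical.propDecidable

/-- The word 1^k 2^k ... n^k. -/
def baseWord (n k : ℕ) : List ℕ := (List.range n).flatMap (fun i => List.replicate k (i+1))

/-- All permutations of the multiset with k copies of each of 1,...,n. -/
noncomputable def multiPerms (n k : ℕ) : Finset (List ℕ) := (baseWord n k).permutations.toFinset

/-- Number of descents of a word. -/
def des (w : List ℕ) : ℕ := ((w.zip w.tail).filter (fun p => decide (p.2 < p.1))).length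
/-- Number of plateaus of a word. -/
def plat (w : List ℕ) : ℕ := ((w.zip w.tail).filter (fun p => decide (p.2 = p.1))).length
/-- Number of weak descents of a word. -/
def wdes (w : List ℕ) : ℕ := ((w.zip w.tail).filter (fun p => decide (p.2 ≤ p.1))).length

/-- Avoidance of the patterns 1221 and 2112: there are no positions i < j < l < m with
w_i = w_m, w_j = w_l and w_i ≠ w_j. -/
def avoids (w : List ℕ) : Prop := ∀ i j l m, i < j → j < l → l < m → m < w.length →
  w.getD i 0 = w.getD m 0 → w.getD j 0 = w.getD l 0 → w.getD i 0 = w.getD j 0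

/-- Nonnesting permutations of the multiset {1,1,...,n,n}. -/
noncomputable def nonnest (n : ℕ) : Finset (List ℕ) := (multiPerms n 2).filter avoids

/-- Dyck words: E = true, N = false, n steps of each kind, every prefix staying
weakly below the diagonal. -/
noncomputable def dyckWords (n : ℕ) : Finset (List Bool) :=
  ((List.replicate n true ++ List.replicate n false).permutations.toFinset).filter
    (fun s => ∀ k, (s.take k).count false ≤ (s.take k).count true)

/-- A peak is a consecutive EN pair. -/
def isPeak (s : List Bool) (i : ℕ) : Prop :=
  i + 1 < s.length ∧ s.getD i false = true ∧ s.getD (i+1) true = false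

/-- A low peak is a peak touching the diagonal. -/
def isLowPeak (s : List Bool) (i : ℕ) : Prop :=
  isPeak s i ∧ (s.take (i+1)).count true = (s.take (i+1)).count false + 1

/-- Number of peaks. -/
noncomputable def pea (s : List Bool) : ℕ :=
  ((Finset.range s.length).filter (fun i => isPeak s i)).card
/-- Number of low peaks. -/
noncomputable def lpea (s : List Bool) : ℕ :=
  ((Finset.range s.length).filter (fun i => isLowPeak s i)).card
/-- Number of high peaks. -/
noncomputable def hpea (s : List Bool) : ℕ :=
  ((Finset.range s.length).filter (fun i => isPeak s i ∧ ¬ isLowPeak s i)).card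

/-- Bivariate Narayana polynomial N_n(t,u), t = X 0, u = X 1. -/
noncomputable def Npoly (n : ℕ) : MvPolynomial (Fin 2) ℚ :=
  ∑ D ∈ dyckWords n, (MvPolynomial.X 0) ^ hpea D * (MvPolynomial.X 1) ^ lpea D


noncomputable def adj (R : ℕ → ℕ → Prop) : List ℕ → ℕ
  | [] => 0
  | [_] => 0
  | x :: y :: l => (if R x y then 1 else 0) + adj R (y :: l)

def fill : ℕ → ℕ → List Bool → List ℕ
  | _, _, [] => []
  | i, j, true :: s => i :: fill (i+1) j s
  | i, j, false :: s => j :: fill i (j+1) s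

def Pth (n : ℕ) : ℕ → ℕ → List Bool → Prop
  | i, j, [] => i = n ∧ j = n
  | i, j, true :: s => Pth n (i+1) j s
  | i, j, false :: s => j < i ∧ Pth n i (j+1) s

theorem des_map (σ : ℕ → ℕ) (w : List ℕ) :
    des (w.map σ) = adj (fun x y => σ y < σ x) w := by
  induction w with
  | nil => simp [des, adj]
  | cons x l ih =>
    cases l with
    | nil => simp [des, adj]
    | cons y l =>
      simp only [des, List.map_cons, List.tail_cons, List.zip_cons_cons, List.filter_cons, adj] at ih ⊢
      rw [← ih]
      by_cases h : σ y < σ x <;> simp [h, Nat.add_comm]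

theorem plat_map (σ : ℕ → ℕ) (w : List ℕ) :
    plat (w.map σ) = adj (fun x y => σ y = σ x) w := by
  induction w with
  | nil => simp [plat, adj]
  | cons x l ih =>
    cases l with
    | nil => simp [plat, adj]
    | cons y l =>
      simp only [plat, List.map_cons, List.tail_cons, List.zip_cons_cons, List.filter_cons, adj] at ih ⊢
      rw [← ih]
      by_cases h : σ y = σ x <;> simp [h, Nat.add_comm]

theorem adj_congr (R R' : ℕ → ℕ → Prop) (w : List ℕ)
    (h : ∀ x ∈ w, ∀ y ∈ w, (R x y ↔ R' x y)) : adj R w = adj R' w := by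
  induction w with
  | nil => simp [adj]
  | cons x l ih =>
    cases l with
    | nil => simp [adj]
    | cons y l =>
      simp only [adj]
      rw [ih (fun u hu v hv => h u (by simp [hu]) v (by simp [hv]))]
      simp only [h x (by simp) y (by simp)]

theorem Pth_le {n : ℕ} : ∀ {s : List Bool} {i j : ℕ}, Pth n i j s → j ≤ n ∧ i ≤ n
  | [], i, j, h => by simp only [Pth] at h; omega
  | true :: s, i, j, h => by
      simp only [Pth] at h
      have := Pth_le h; omega
  | false :: s, i, j, h => by
      simp only [Pth] at h
      have := Pth_le h.2; omega

/-- count in the filled word -/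
theorem count_fill {n : ℕ} (x : ℕ) : ∀ {s : List Bool} {i j : ℕ}, Pth n i j s →
    (fill i j s).count x = (if i ≤ x ∧ x < n then 1 else 0) + (if j ≤ x ∧ x < n then 1 else 0)
  | [], i, j, h => by
      simp only [Pth] at h
      simp only [fill, List.count_nil]
      split_ifs <;> omega
  | true :: s, i, j, h => by
      simp only [Pth] at h
      have := Pth_le h
      simp only [fill, List.count_cons, count_fill x h, beq_iff_eq]
      split_ifs <;> omega
  | false :: s, i, j, h => by
      simp only [Pth] at h
      have := Pth_le h.2
      simp only [fill, List.count_cons, count_fill x h.2, beq_iff_eq]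
      split_ifs <;> omega

theorem mem_fill {n x : ℕ} {s : List Bool} {i j : ℕ} (h : Pth n i j s) :
    x ∈ fill i j s ↔ (i ≤ x ∨ j ≤ x) ∧ x < n := by
  rw [← List.count_pos_iff, count_fill x h]
  split_ifs <;> omega

theorem fill_inj {n : ℕ} : ∀ {s s' : List Bool} {i j : ℕ}, Pth n i j s → Pth n i j s' → 
    fill i j s = fill i j s' → s = s'
  | [], [], i, j, h, h', e => rfl
  | [], true :: s, i, j, h, h', e => by simp [fill] at e
  | [], false :: s, i, j, h, h', e => by simp [fill] at e
  | true :: s, [], i, j, h, h', e => by simp [fill] at e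
  | false :: s, [], i, j, h, h', e => by simp [fill] at e
  | true :: s, true :: s', i, j, h, h', e => by
      simp only [fill, List.cons.injEq, true_and, Pth] at e h h' ⊢
      exact fill_inj h h' e
  | false :: s, false :: s', i, j, h, h', e => by
      simp only [fill, List.cons.injEq, true_and, Pth] at e h h' ⊢
      exact fill_inj h.2 h'.2 e
  | true :: s, false :: s', i, j, h, h', e => by
      simp only [fill, List.cons.injEq, Pth] at e h h' ⊢
      omega
  | false :: s, true :: s', i, j, h, h', e => by
      simp only [fill, List.cons.injEq, Pth] at e h h' ⊢
      omega

theorem dedup_fill {n : ℕ} : ∀ {s : List Bool} {i j : ℕ}, j ≤ i → Pth n i j s →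
    (fill i j s).dedup = List.range' j (n - j)
  | [], i, j, hij, h => by
      simp only [Pth] at h
      simp [fill, h.2]
  | true :: s, i, j, hij, h => by
      simp only [Pth] at h
      have := Pth_le h
      simp only [fill]
      rw [List.dedup_cons_of_mem, dedup_fill (by omega) h]
      rw [mem_fill h]; omega
  | false :: s, i, j, hij, h => by
      simp only [Pth] at h
      have := Pth_le h.2
      simp only [fill]
      rw [List.dedup_cons_of_notMem, dedup_fill (by omega) h.2]
      · have : n - j = (n - (j+1)) + 1 := by omega
        rw [this, List.range'_succ]
      rw [mem_fill h.2]; omega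

/-! avoidance -/
theorem order_fill {n x y : ℕ} : ∀ {s : List Bool} {i j : ℕ}, Pth n i j s → y < i → x < i →
    [y, x].Sublist (fill i j s) → y < x
  | [], i, j, h, hy, hx, hs => by simp [fill] at hs
  | true :: s, i, j, h, hy, hx, hs => by
      simp only [Pth, fill] at h hs
      rw [List.sublist_cons_iff] at hs
      rcases hs with hs | ⟨r, hr, hs⟩
      · exact order_fill h (by omega) (by omega) hs
      · simp at hr; omega
  | false :: s, i, j, h, hy, hx, hs => by
      simp only [Pth, fill] at h hs
      rw [List.sublist_cons_iff] at hs
      rcases hs with hs | ⟨r, hr, hs⟩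
      · exact order_fill h.2 (by omega) (by omega) hs
      · simp at hr
        rw [← hr.2, List.singleton_sublist, mem_fill h.2] at hs
        omega

theorem order_fill2 {n x y : ℕ} : ∀ {s : List Bool} {i j : ℕ}, Pth n i j s → x < i → 
    [y, y, x].Sublist (fill i j s) → False
  | [], i, j, h, hx, hs => by simp [fill] at hs
  | true :: s, i, j, h, hx, hs => by
      simp only [Pth, fill] at h hs
      rw [List.sublist_cons_iff] at hs
      rcases hs with hs | ⟨r, hr, hs⟩
      · exact order_fill2 h (by omega) hs
      · simp at hr
        rw [← hr.2] at hs
        have := order_fill h (by omega) (by omega) hs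
        omega
  | false :: s, i, j, h, hx, hs => by
      simp only [Pth, fill] at h hs
      rw [List.sublist_cons_iff] at hs
      rcases hs with hs | ⟨r, hr, hs⟩
      · exact order_fill2 h.2 (by omega) hs
      · simp at hr
        rw [← hr.2] at hs
        have := hs.subset (List.mem_cons_self)
        rw [mem_fill h.2] at this
        omega

theorem avoid_fill {n x y : ℕ} : ∀ {s : List Bool} {i j : ℕ}, Pth n i j s →
    ¬ [x, y, y, x].Sublist (fill i j s)
  | [], i, j, h, hs => by simp [fill] at hs
  | true :: s, i, j, h, hs => by
      simp only [Pth, fill] at h hs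
      rw [List.sublist_cons_iff] at hs
      rcases hs with hs | ⟨r, hr, hs⟩
      · exact avoid_fill h hs
      · simp at hr
        rw [← hr.2] at hs
        exact order_fill2 h (by omega) hs
  | false :: s, i, j, h, hs => by
      simp only [Pth, fill] at h hs
      rw [List.sublist_cons_iff] at hs
      rcases hs with hs | ⟨r, hr, hs⟩
      · exact avoid_fill h.2 hs
      · simp at hr
        rw [← hr.2] at hs
        have := hs.subset (a := x) (by simp)
        rw [mem_fill h.2] at this
        omega

theorem avoids_iff (w : List ℕ) : avoids w ↔ ∀ x y, [x, y, y, x].Sublist w → x = y := by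
  constructor
  · intro h x y hs
    obtain ⟨f, hf⟩ := List.sublist_iff_exists_fin_orderEmbedding_get_eq.1 hs
    have e0 := hf 0
    have e1 := hf 1
    have e2 := hf 2
    have e3 := hf 3
    have l1 : f 0 < f 1 := f.lt_iff_lt.2 (by simp)
    have l2 : f 1 < f 2 := f.lt_iff_lt.2 (by simp [Fin.lt_def])
    have l3 : f 2 < f 3 := f.lt_iff_lt.2 (by simp [Fin.lt_def])
    simp at e0 e1 e2 e3
    have := h (f 0) (f 1) (f 2) (f 3) l1 l2 l3 (f 3).2
    simp [List.getD_eq_getElem, ← e0, ← e1, ← e2, ← e3] at this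
    exact this
  · intro h i j l m hij hjl hlm hm e1 e2
    apply h
    rw [List.getD_eq_getElem _ _ (by omega), List.getD_eq_getElem _ _ (by omega)] at e1 e2
    rw [List.getD_eq_getElem _ _ (by omega), List.getD_eq_getElem _ _ (by omega)]
    have := List.map_getElem_sublist (l := w)
      (is := [⟨i, by omega⟩, ⟨j, by omega⟩, ⟨l, by omega⟩, ⟨m, by omega⟩])
      (by simp; omega)
    simpa [← e1, ← e2] using this

theorem dyck_iff_aux (n : ℕ) : ∀ (s : List Bool) (i j : ℕ), j ≤ i → 
    (Pth n i j s ↔ i + s.count true = n ∧ j + s.count false = n ∧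
      ∀ k, j + (s.take k).count false ≤ i + (s.take k).count true)
  | [], i, j, h => by
     simp only [Pth]; simp; intros; omega
  | true :: s, i, j, h => by
     simp only [Pth]
     rw [dyck_iff_aux n s (i+1) j (by omega)]
     simp only [List.count_cons]
     constructor
     · rintro ⟨h1, h2, h3⟩
       refine ⟨by simp; omega, by simp; omega, ?_⟩
       intro k
       cases k with
       | zero => simpa using h
       | succ k => have := h3 k; simp; omega
     · rintro ⟨h1, h2, h3⟩
       simp at h1 h2
       refine ⟨by omega, by omega, ?_⟩
       intro k
       have := h3 (k+1); simp at this; omega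
  | false :: s, i, j, h => by
     simp only [Pth]
     constructor
     · rintro ⟨h0, h⟩
       rw [dyck_iff_aux n s i (j+1) (by omega)] at h
       obtain ⟨h1, h2, h3⟩ := h
       refine ⟨by simp; omega, by simp; omega, ?_⟩
       intro k
       cases k with
       | zero => simp; omega
       | succ k => have := h3 k; simp; omega
     · rintro ⟨h1, h2, h3⟩
       have h0 := h3 1
       simp at h0 h1 h2
       refine ⟨by omega, ?_⟩
       rw [dyck_iff_aux n s i (j+1) (by omega)]
       refine ⟨by omega, by omega, ?_⟩
       intro k
       have := h3 (k+1); simp at this; omega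

theorem dyck_iff (n : ℕ) (s : List Bool) : s ∈ dyckWords n ↔ Pth n 0 0 s := by
  rw [dyck_iff_aux n s 0 0 le_rfl]
  simp only [dyckWords, Finset.mem_filter, List.mem_toFinset, List.mem_permutations,
    List.perm_iff_count, zero_add, List.count_append, List.count_replicate]
  simp [and_assoc]
  tauto

/-! swap -/
def swap2 : List Bool → List Bool
  | x :: y :: s => y :: x :: s
  | l => l

def sw (a b : ℕ) : ℕ → ℕ → List Bool → List Bool
  | _, _, [] => []
  | i, j, true :: s => if i = b ∧ j = a then swap2 (true :: s) else true :: sw a b (i+1) j s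
  | i, j, false :: s => if i = b ∧ j = a then swap2 (false :: s) else false :: sw a b i (j+1) s

theorem sw_at (a b : ℕ) (s : List Bool) : sw a b b a s = swap2 s := by
  rcases s with _ | ⟨_ | _, s⟩ <;> simp [sw, swap2]

theorem swap2_swap2 (s : List Bool) : swap2 (swap2 s) = s := by
  rcases s with _ | ⟨x, _ | ⟨y, s⟩⟩ <;> simp [swap2]

theorem sw_sw (a b : ℕ) : ∀ (s : List Bool) (i j : ℕ), sw a b i j (sw a b i j s) = s
  | [], i, j => by simp [sw]
  | true :: s, i, j => by
      by_cases h : i = b ∧ j = a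
      · rw [h.1, h.2, sw_at, sw_at, swap2_swap2]
      · simp [sw, h, sw_sw a b s]
  | false :: s, i, j => by
      by_cases h : i = b ∧ j = a
      · rw [h.1, h.2, sw_at, sw_at, swap2_swap2]
      · simp [sw, h, sw_sw a b s]

theorem sw_Pth {n a b : ℕ} (hab : a < b) : ∀ {s : List Bool} {i j : ℕ}, Pth n i j s →
    Pth n i j (sw a b i j s)
  | [], i, j, h => by simpa [sw] using h
  | true :: s, i, j, h => by
      by_cases h' : i = b ∧ j = a
      · obtain ⟨rfl, rfl⟩ := h'
        rw [sw_at]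
        rcases s with _ | ⟨_ | _, s⟩ <;> simp_all [swap2, Pth]
      · simp only [sw, h', if_false, Pth] at h ⊢
        exact sw_Pth hab h
  | false :: s, i, j, h => by
      by_cases h' : i = b ∧ j = a
      · obtain ⟨rfl, rfl⟩ := h'
        rw [sw_at]
        rcases s with _ | ⟨_ | _, s⟩ <;> simp_all [swap2, Pth]
        omega
      · simp only [sw, h', if_false, Pth] at h ⊢
        exact ⟨h.1, sw_Pth hab h.2⟩

section swapsec
variable {n a b : ℕ} {R R' : ℕ → ℕ → Prop}

theorem adj_past (hab : a + 2 ≤ b)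
    (hR : ∀ x y, ¬(x = a ∧ y = b) → ¬(x = b ∧ y = a) → (R x y ↔ R' x y)) :
    ∀ {s : List Bool} {i j c : ℕ}, j ≤ i → (c + 1 = i ∨ c + 1 = j) → Pth n i j s →
      a + b + 2 ≤ i + j →
      adj R (c :: fill i j s) = adj R' (c :: fill i j s)
  | [], i, j, c, hji, hc, h, hs => by simp [fill, adj]
  | true :: s, i, j, c, hji, hc, h, hs => by
      simp only [Pth] at h
      simp only [fill, adj]
      rw [adj_past hab hR (by omega) (by omega) h (by omega)]
      simp only [hR c i (by omega) (by omega)]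
  | false :: s, i, j, c, hji, hc, h, hs => by
      simp only [Pth] at h
      simp only [fill, adj]
      rw [adj_past hab hR (by omega) (by omega) h.2 (by omega)]
      simp only [hR c j (by omega) (by omega)]

theorem adj_sw (hab : a + 2 ≤ b)
    (hR : ∀ x y, ¬(x = a ∧ y = b) → ¬(x = b ∧ y = a) → (R x y ↔ R' x y))
    (h1 : R b a ↔ R' a b) (h2 : R a b ↔ R' b a)
    (h3 : ∀ c, c ≠ a → c ≠ b → (R c b ↔ R' c a) ∧ (R c a ↔ R' c b) ∧ (R b c ↔ R' a c) ∧
      (R a c ↔ R' b c)) :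
    ∀ {s : List Bool} {i j c : ℕ}, j ≤ i → (c + 1 = i ∨ c + 1 = j) → Pth n i j s →
      ¬(i = b + 1 ∧ j = a ∧ c = b) → ¬(i = b ∧ j = a + 1 ∧ c = a) →
      adj R (c :: fill i j s) = adj R' (c :: fill i j (sw a b i j s))
  | [], i, j, c, hji, hc, h, _, _ => by simp [fill, adj, sw]
  | true :: s, i, j, c, hji, hc, h, q1, q2 => by
      by_cases hp : i = b ∧ j = a
      · obtain ⟨rfl, rfl⟩ := hp
        rw [sw_at]
        have hca := h3 c (by omega) (by omega)
        rcases s with _ | ⟨_ | _, s⟩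
        · simp only [swap2, fill, adj]
          simp only [hR c i (by omega) (by omega)]
        · simp only [swap2, fill, Pth] at h ⊢
          have : ∀ k, adj R (k :: fill (i+1) (j+1) s) = adj R' (k :: fill (i+1) (j+1) s) ∨ (k ≠ i ∧ k ≠ j) := by
            intro k
            by_cases hk : k = i ∨ k = j
            · left; exact adj_past hab hR (by omega) (by omega) h.2 (by omega)
            · right; omega
          rcases s with _ | ⟨_ | _, s⟩
          · simp only [fill, adj]
            simp only [hca, h1]
          · simp only [fill, Pth] at h ⊢
            have e := adj_past hab hR (c := j+1) (by omega) (by omega) h.2.2 (by omega)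
            simp only [adj, hca, h1, e, h3 (j+1) (by omega) (by omega)]
          · simp only [fill, Pth] at h ⊢
            have e := adj_past hab hR (c := i+1) (by omega) (by omega) h.2 (by omega)
            simp only [adj, hca, h1, e, h3 (i+1) (by omega) (by omega)]
        · simp only [swap2, fill, Pth] at h ⊢
          have e := adj_past hab hR (c := i+1) (by omega) (by omega) h (by omega)
          simp only [adj, e, hR c i (by omega) (by omega), hR i (i+1) (by omega) (by omega)]
      · simp only [sw, hp, if_false, Pth, fill, adj] at h ⊢
        rw [adj_sw hab hR h1 h2 h3 (by omega) (by omega) h (by omega) (by omega)]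
        simp only [hR c i (by omega) (by omega)]
  | false :: s, i, j, c, hji, hc, h, q1, q2 => by
      by_cases hp : i = b ∧ j = a
      · obtain ⟨rfl, rfl⟩ := hp
        rw [sw_at]
        have hca := h3 c (by omega) (by omega)
        rcases s with _ | ⟨_ | _, s⟩
        · simp only [swap2, fill, adj]
          simp only [hR c j (by omega) (by omega)]
        · simp only [swap2, fill, Pth] at h ⊢
          have e := adj_past hab hR (c := j+1) (by omega) (by omega) h.2.2 (by omega)
          simp only [adj, e, hR c j (by omega) (by omega), hR j (j+1) (by omega) (by omega)]
        · simp only [swap2, fill, Pth] at h ⊢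
          rcases s with _ | ⟨_ | _, s⟩
          · simp only [fill, adj]
            simp only [hca, h2]
          · simp only [fill, Pth] at h ⊢
            have e := adj_past hab hR (c := j+1) (by omega) (by omega) h.2.2 (by omega)
            simp only [adj, hca, h2, e, h3 (j+1) (by omega) (by omega)]
          · simp only [fill, Pth] at h ⊢
            have e := adj_past hab hR (c := i+1) (by omega) (by omega) h.2 (by omega)
            simp only [adj, hca, h2, e, h3 (i+1) (by omega) (by omega)]
      · simp only [sw, hp, if_false, Pth, fill, adj] at h ⊢
        rw [adj_sw hab hR h1 h2 h3 (by omega) (by omega) h.2 (by omega) (by omega)]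
        simp only [hR c j (by omega) (by omega)]

theorem adj_sw0 (hab : a + 2 ≤ b)
    (hR : ∀ x y, ¬(x = a ∧ y = b) → ¬(x = b ∧ y = a) → (R x y ↔ R' x y))
    (h1 : R b a ↔ R' a b) (h2 : R a b ↔ R' b a)
    (h3 : ∀ c, c ≠ a → c ≠ b → (R c b ↔ R' c a) ∧ (R c a ↔ R' c b) ∧ (R b c ↔ R' a c) ∧
      (R a c ↔ R' b c)) {s : List Bool} (h : Pth n 0 0 s) :
    adj R (fill 0 0 s) = adj R' (fill 0 0 (sw a b 0 0 s)) := by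
  rcases s with _ | ⟨_ | _, s⟩
  · simp [fill, sw, adj]
  · simp [Pth] at h
  · have : ¬ (0 = b ∧ 0 = a) := by omega
    simp only [Pth, sw, this, if_false, fill] at h ⊢
    exact adj_sw hab hR h1 h2 h3 (by omega) (by omega) h (by omega) (by omega)
end swapsec

/-! rotation -/
theorem adj_rot (R R' : ℕ → ℕ → Prop) (m : ℕ) : ∀ (l : List ℕ) (c : ℕ),
    (∀ x ∈ c :: l, ∀ y ∈ c :: l, (if R x y then 1 else 0) + (if y = m then 1 else 0) =
      (if R' x y then 1 else 0) + (if x = m then 1 else 0)) →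
    adj R (c :: l) + (if (c :: l).getLast (by simp) = m then 1 else 0)
      = adj R' (c :: l) + (if c = m then 1 else 0)
  | [], c, h => by by_cases hc : c = m <;> simp [adj, hc]
  | y :: l, c, h => by
     have ih := adj_rot R R' m l y (fun u hu v hv => h u (List.mem_cons_of_mem _ hu) v (List.mem_cons_of_mem _ hv))
     have := h c (by simp) y (by simp)
     simp only [adj, List.getLast_cons_cons] at ih ⊢
     by_cases hl : (y :: l).getLast (by simp) = m <;> simp only [hl, if_true, if_false] at ih ⊢ <;> omega

theorem fill_last {n : ℕ} : ∀ {s : List Bool} {i j : ℕ}, j < i → Pth n i j s → 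
    (fill i j s).getLast? = some (n - 1)
  | [], i, j, hji, h => by simp only [Pth] at h; omega
  | true :: s, i, j, hji, h => by
      simp only [Pth] at h
      simp only [fill, List.getLast?_cons]
      rw [fill_last (by omega) h]; rfl
  | false :: s, i, j, hji, h => by
      simp only [Pth] at h
      simp only [fill, List.getLast?_cons]
      by_cases hj : j + 1 < i
      · rw [fill_last (by omega) h.2]; rfl
      · have : i = j + 1 := by omega
        subst this
        rcases s with _ | ⟨_ | _, s⟩
        · simp [Pth] at h; simp [fill, ← h]
        · simp [Pth] at h
        · simp [Pth] at h
          simp only [fill, List.getLast?_cons]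
          rw [fill_last (by omega) h]; rfl

/-! peaks -/
noncomputable def pk (P : ℕ → ℕ → Prop) (i j : ℕ) (s : List Bool) : ℕ :=
  ((Finset.range s.length).filter (fun p => isPeak s p ∧
    P (i + (s.take (p+1)).count true) (j + (s.take (p+1)).count false))).card

theorem pk_cons (P : ℕ → ℕ → Prop) (i j : ℕ) (x : Bool) (s : List Bool) :
    pk P i j (x :: s) = (if x = true ∧ s.head? = some false ∧ P (i+1) j then 1 else 0) +
      pk P (i + if x = true then 1 else 0) (j + if x = true then 0 else 1) s := by
  unfold pk
  rw [Finset.card_filter, Finset.card_filter, List.length_cons, Finset.sum_range_succ', add_comm]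
  congr 1
  · congr 1
    rcases s with _ | ⟨y, s⟩
    · simp [isPeak]
    · cases x <;> cases y <;> simp [isPeak]
  · apply Finset.sum_congr rfl
    intro p _
    congr 1
    cases x <;> simp [isPeak, add_assoc, add_comm 1] <;> (intros; omega)

theorem adj_fill_pk {n : ℕ} (P : ℕ → ℕ → Prop) (R : ℕ → ℕ → Prop)
    (hEN : ∀ i j, j ≤ i → i < n → (R i j ↔ P (i+1) j)) (hNE : ∀ i j, j < i → i < n → ¬ R j i)
    (hE : ∀ i, i + 1 < n → ¬ R i (i+1)) :
    ∀ {s : List Bool} {i j : ℕ}, j ≤ i → Pth n i j s → adj R (fill i j s) = pk P i j s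
  | [], i, j, hji, h => by simp [fill, adj, pk]
  | true :: s, i, j, hji, h => by
      have ih := adj_fill_pk P R hEN hNE hE (s := s) (i := i+1) (j := j) (by omega) h
      rw [pk_cons]
      simp only [Pth] at h
      simp only [if_true, add_zero, ← ih]
      have := Pth_le h
      rcases s with _ | ⟨_ | _, s⟩
      · simp [fill, adj]
      · simp [fill, adj, hEN i j hji (by omega)]
      · simp only [Pth] at h
        have := Pth_le h
        simp [fill, adj, hE i (by omega)]
  | false :: s, i, j, hji, h => by
      simp only [Pth] at h
      have ih := adj_fill_pk P R hEN hNE hE (s := s) (i := i) (j := j+1) (by omega) h.2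
      rw [pk_cons]
      simp only [Bool.false_eq_true, if_false, false_and, add_zero, zero_add, ← ih]
      rcases s with _ | ⟨_ | _, s⟩
      · simp [fill, adj]
      · simp only [Pth] at h
        have := Pth_le h.2.2
        simp [fill, adj, hE j (by omega)]
      · simp only [Pth] at h
        have := Pth_le h.2
        simp [fill, adj, hNE i j (by omega) (by omega)]

theorem lpea_eq (s : List Bool) : lpea s = pk (fun c d => c = d + 1) 0 0 s := by
  unfold lpea pk isLowPeak
  congr 1
  ext x
  simp only [zero_add, Finset.mem_filter]
theorem hpea_eq (s : List Bool) : hpea s = pk (fun c d => ¬ c = d + 1) 0 0 s := by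
  unfold hpea pk isLowPeak
  congr 1
  ext x
  simp only [zero_add, Finset.mem_filter]; tauto

theorem adj_rot' (R R' : ℕ → ℕ → Prop) (m c d : ℕ) (w : List ℕ) (hh : w.head? = some c)
    (hl : w.getLast? = some d) (hd : d ≠ m)
    (h : ∀ x ∈ w, ∀ y ∈ w, (if R x y then 1 else 0) + (if y = m then 1 else 0) =
      (if R' x y then 1 else 0) + (if x = m then 1 else 0)) :
    adj R w = adj R' w + (if c = m then 1 else 0) := by
  rcases w with _ | ⟨x, l⟩
  · simp at hh
  · simp at hh
    subst hh
    have := adj_rot R R' m l x h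
    rw [List.getLast?_eq_some_getLast (by simp)] at hl
    simp only [Option.some.injEq] at hl
    rw [hl] at this
    simpa [hd] using this

theorem adj_range'_congr (R R' : ℕ → ℕ → Prop) (h : ∀ x, R x (x+1) ↔ R' x (x+1)) :
    ∀ k i, adj R (List.range' i k) = adj R' (List.range' i k)
  | 0, i => by simp [adj]
  | 1, i => by simp [adj]
  | k+2, i => by
    have := adj_range'_congr R R' h (k+1) (i+1)
    simp only [List.range'_succ, adj] at this ⊢
    rw [this]; simp only [h]

def Dc (σ : ℕ → ℕ) : ℕ → ℕ → Prop := fun x y => σ y < σ x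

structure Good (n : ℕ) (σ : ℕ → ℕ) : Prop where
  out : ∀ i, n ≤ i → σ i = 0
  pos : ∀ i, i < n → 0 < σ i
  inj : ∀ i j, i < n → j < n → σ i = σ j → i = j

noncomputable def Gp (n : ℕ) (σ : ℕ → ℕ) : MvPolynomial (Fin 2) ℚ :=
  ∑ D ∈ dyckWords n, (MvPolynomial.X 0) ^ adj (Dc σ) (fill 0 0 D) *
    (MvPolynomial.X 1) ^ adj (fun x y => y = x) (fill 0 0 D)

noncomputable def Mm (n : ℕ) (σ : ℕ → ℕ) : ℕ :=
  ∑ i ∈ Finset.range (n-1), if Dc σ i (i+1) then i + 1 else 0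

theorem Gp_swap {n a b : ℕ} {σ : ℕ → ℕ} (hab : a + 2 ≤ b) (hlt : σ a < σ b)
    (hbet : ∀ x, x ≠ a → x ≠ b → σ x < σ a ∨ σ b < σ x) :
    Gp n σ = Gp n (σ ∘ Equiv.swap a b) := by
  unfold Gp
  have sa : (σ ∘ Equiv.swap a b) a = σ b := by simp
  have sb : (σ ∘ Equiv.swap a b) b = σ a := by simp
  have sc : ∀ c, c ≠ a → c ≠ b → (σ ∘ Equiv.swap a b) c = σ c := by
    intro c h1 h2; simp [Equiv.swap_apply_of_ne_of_ne h1 h2]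
  refine Finset.sum_nbij' (sw a b 0 0) (sw a b 0 0) ?_ ?_ ?_ ?_ ?_
  · intro D hD; rw [dyck_iff] at hD ⊢; exact sw_Pth (by omega) hD
  · intro D hD; rw [dyck_iff] at hD ⊢; exact sw_Pth (by omega) hD
  · intro D hD; exact sw_sw ..
  · intro D hD; exact sw_sw ..
  · intro D hD
    rw [dyck_iff] at hD
    congr 2
    · apply adj_sw0 hab _ _ _ _ hD
      · intro x y h1 h2
        unfold Dc
        by_cases xa : x = a
        · subst xa
          by_cases ya : y = x
          · subst ya; simp
          · rw [sa, sc y ya (by tauto)]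
            have := hbet y ya (by tauto)
            omega
        · by_cases xb : x = b
          · subst xb
            by_cases ya : y = x
            · subst ya; simp
            · rw [sb, sc y (by tauto) ya]
              have := hbet y (by tauto) ya
              omega
          · rw [sc x xa xb]
            have := hbet x xa xb
            by_cases ya : y = a
            · subst ya; rw [sa]; omega
            · by_cases yb : y = b
              · subst yb; rw [sb]; omega
              · rw [sc y ya yb]
      · unfold Dc; rw [sa, sb]
      · unfold Dc; rw [sa, sb]
      · intro c h1 h2
        unfold Dc; rw [sa, sb, sc c h1 h2]; simp
    · apply adj_sw0 hab _ _ _ _ hD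
      · intros; rfl
      · constructor <;> intro h <;> omega
      · constructor <;> intro h <;> omega
      · intro c h1 h2
        refine ⟨?_, ?_, ?_, ?_⟩ <;> constructor <;> intro h <;> omega

/-- comparisons of consecutive indices are unchanged -/
theorem swap_adj {a b : ℕ} {σ : ℕ → ℕ} (hab : a + 2 ≤ b) (hlt : σ a < σ b)
    (hbet : ∀ x, x ≠ a → x ≠ b → σ x < σ a ∨ σ b < σ x) (x y : ℕ) (h : y = x + 1 ∨ x = y + 1) :
    Dc σ x y ↔ Dc (σ ∘ Equiv.swap a b) x y := by
  have sa : (σ ∘ Equiv.swap a b) a = σ b := by simp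
  have sb : (σ ∘ Equiv.swap a b) b = σ a := by simp
  have sc : ∀ c, c ≠ a → c ≠ b → (σ ∘ Equiv.swap a b) c = σ c := by
    intro c h1 h2; simp [Equiv.swap_apply_of_ne_of_ne h1 h2]
  unfold Dc
  by_cases xa : x = a
  · subst xa
    rw [sa, sc y (by omega) (by omega)]
    have := hbet y (by omega) (by omega)
    omega
  · by_cases xb : x = b
    · subst xb
      rw [sb, sc y (by omega) (by omega)]
      have := hbet y (by omega) (by omega)
      omega
    · rw [sc x xa xb]
      have := hbet x xa xb
      by_cases ya : y = a
      · subst ya; rw [sa]; omega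
      · by_cases yb : y = b
        · subst yb; rw [sb]; omega
        · rw [sc y ya yb]

theorem Good_swap {n a b : ℕ} {σ : ℕ → ℕ} (hg : Good n σ) (ha : a < n) (hb : b < n) :
    Good n (σ ∘ Equiv.swap a b) := by
  have lt : ∀ i, Equiv.swap a b i < n ↔ i < n := by
    intro i
    by_cases h1 : i = a
    · subst h1; simp [ha, hb]
    · by_cases h2 : i = b
      · subst h2; simp [ha, hb]
      · rw [Equiv.swap_apply_of_ne_of_ne h1 h2]
  constructor
  · intro i hi
    apply hg.out
    have := lt i
    omega
  · intro i hi; exact hg.pos _ ((lt i).2 hi)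
  · intro i j hi hj h
    have := hg.inj _ _ ((lt i).2 hi) ((lt j).2 hj) h
    exact (Equiv.swap a b).injective this

def rot (n m : ℕ) (σ : ℕ → ℕ) : ℕ → ℕ := fun i => if i = m then 1 else if i < n then σ i + 1 else 0

theorem Good_rot {n m : ℕ} {σ : ℕ → ℕ} (hg : Good n σ) (hm : m < n) : Good n (rot n m σ) := by
  constructor
  · intro i hi; unfold rot; rw [if_neg (by omega), if_neg (by omega)]
  · intro i hi; unfold rot; split_ifs <;> omega
  · intro i j hi hj h
    have := hg.inj i j hi hj
    have := hg.pos i hi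
    have := hg.pos j hj
    unfold rot at h
    split_ifs at h <;> omega

theorem rot_rel {n m : ℕ} {σ : ℕ → ℕ} (hg : Good n σ) (hm : m < n)
    (hmax : ∀ x, x < n → x ≠ m → σ x < σ m) (x y : ℕ) (hx : x < n) (hy : y < n) :
    (if Dc σ x y then 1 else 0) + (if y = m then 1 else 0) =
      (if Dc (rot n m σ) x y then 1 else 0) + (if x = m then 1 else 0) := by
  have p1 := hg.pos x hx
  have p2 := hg.pos y hy
  have q1 := hmax x hx
  have q2 := hmax y hy
  unfold Dc rot
  by_cases h1 : x = m
  · subst h1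
    by_cases h2 : y = x
    · subst h2; simp
    · simp [h2, hy, q2 h2]
  · by_cases h2 : y = m
    · subst h2
      have := q1 h1
      simp only [h1, hx, if_true, if_false]
      rw [if_neg (by omega), if_pos (by omega)]
    · simp [h1, h2, hx, hy]

theorem fill_head {n : ℕ} {s : List Bool} (hn : 0 < n) (h : Pth n 0 0 s) :
    (fill 0 0 s).head? = some 0 ∧ (fill 0 0 s).getLast? = some (n-1) := by
  rcases s with _ | ⟨_ | _, s⟩
  · simp [Pth] at h; omega
  · simp [Pth] at h
  · simp only [Pth] at h
    simp only [fill, List.head?_cons, List.getLast?_cons, true_and]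
    rw [fill_last (by omega) h]; rfl

theorem Gp_rot {n m : ℕ} {σ : ℕ → ℕ} (hg : Good n σ) (hm : m + 1 < n)
    (hmax : ∀ x, x < n → x ≠ m → σ x < σ m) :
    Gp n σ = (MvPolynomial.X 0) ^ (if 0 = m then 1 else 0) * Gp n (rot n m σ) := by
  unfold Gp
  rw [Finset.mul_sum]
  apply Finset.sum_congr rfl
  intro D hD
  rw [dyck_iff] at hD
  have hf := fill_head (by omega) hD
  rw [adj_rot' (Dc σ) (Dc (rot n m σ)) m 0 (n-1) _ hf.1 hf.2 (by omega)]
  · rw [pow_add]; ring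
  · intro x hx y hy
    rw [mem_fill hD] at hx hy
    exact rot_rel hg (by omega) hmax x y hx.2 hy.2

theorem d_rot {n m : ℕ} {σ : ℕ → ℕ} (hg : Good n σ) (hm : m + 1 < n)
    (hmax : ∀ x, x < n → x ≠ m → σ x < σ m) :
    adj (Dc σ) (List.range n) = adj (Dc (rot n m σ)) (List.range n) + (if 0 = m then 1 else 0) := by
  apply adj_rot' (Dc σ) (Dc (rot n m σ)) m 0 (n-1) _ _ _ (by omega)
  · intro x hx y hy
    rw [List.mem_range] at hx hy
    exact rot_rel hg (by omega) hmax x y hx hy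
  · rw [List.head?_range]; simp; omega
  · rw [List.getLast?_range]; simp; omega

theorem M_rot {n m : ℕ} {σ : ℕ → ℕ} (hg : Good n σ) (hm : m + 1 < n)
    (hmax : ∀ x, x < n → x ≠ m → σ x < σ m) :
    Mm n (rot n m σ) < Mm n σ := by
  have key : Mm n σ + ∑ i ∈ Finset.range (n-1), (if i + 1 = m then i + 1 else 0)
      = Mm n (rot n m σ) + ∑ i ∈ Finset.range (n-1), (if i = m then i + 1 else 0) := by
    unfold Mm
    rw [← Finset.sum_add_distrib, ← Finset.sum_add_distrib]
    apply Finset.sum_congr rfl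
    intro i hi
    rw [Finset.mem_range] at hi
    have := rot_rel hg (by omega) hmax i (i+1) (by omega) (by omega)
    split_ifs at this ⊢ <;> omega
  have e1 : ∑ i ∈ Finset.range (n-1), (if i = m then i + 1 else 0) = m + 1 := by
    rw [Finset.sum_eq_single m]
    · simp
    · intro b _ hb; simp [hb]
    · intro h; simp at h; omega
  have e2 : ∑ i ∈ Finset.range (n-1), (if i + 1 = m then i + 1 else 0) ≤ m := by
    rcases m with _ | m
    · simp
    · rw [Finset.sum_eq_single m]
      · simp
      · intro b _ hb; simp [hb]
      · intro h; simp at h; omega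
  omega

theorem base_case {n : ℕ} {σ : ℕ → ℕ} (hg : Good n σ) 
    (hinc : ∀ i, i + 1 < n → σ i < σ (i+1)) :
    Gp n σ = (MvPolynomial.X 0) ^ (adj (Dc σ) (List.range n)) * Npoly n := by
  have mono : ∀ j i, i < j → j < n → σ i < σ j := by
    intro j
    induction j with
    | zero => intro i h; omega
    | succ j ih =>
      intro i h hj
      have h1 := hinc j hj
      rcases Nat.lt_succ_iff_lt_or_eq.1 h with h' | h'
      · have := ih i h' (by omega); omega
      · subst h'; exact h1
  have hd : adj (Dc σ) (List.range n) = 0 := by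
    have : ∀ l : List ℕ, l.Pairwise (· < ·) → (∀ x ∈ l, x < n) → adj (Dc σ) l = 0 := by
      intro l
      induction l with
      | nil => simp [adj]
      | cons x l ih =>
        intro h1 h2
        rcases l with _ | ⟨y, l⟩
        · simp [adj]
        · simp only [adj]
          rw [ih (List.Pairwise.of_cons h1) (fun z hz => h2 z (List.mem_cons_of_mem _ hz))]
          have hxy : x < y := List.rel_of_pairwise_cons h1 (by simp)
          have := mono y x hxy (h2 y (by simp))
          rw [if_neg (by unfold Dc; omega)]
    apply this
    · exact List.pairwise_lt_range
    · simp
  rw [hd, pow_zero, one_mul]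
  unfold Gp Npoly
  apply Finset.sum_congr rfl
  intro D hD
  rw [dyck_iff] at hD
  congr 2
  · rw [hpea_eq]
    apply adj_fill_pk _ _ _ _ _ le_rfl hD
    · intro i j hji hi
      unfold Dc
      rcases Nat.lt_or_eq_of_le hji with h | h
      · have := mono i j h hi; simp; omega
      · subst h; simp
    · intro i j hji hi
      have := mono i j hji hi
      unfold Dc; omega
    · intro i hi
      have := mono (i+1) i (by omega) hi
      unfold Dc; omega
  · rw [lpea_eq]
    apply adj_fill_pk _ _ _ _ _ le_rfl hD
    · intro i j _ _; constructor <;> intro h <;> omega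
    · intros; omega
    · intros; omega

theorem main_ind (n : ℕ) : ∀ M, ∀ σ : ℕ → ℕ, Good n σ → Mm n σ = M →
    Gp n σ = (MvPolynomial.X 0) ^ (adj (Dc σ) (List.range n)) * Npoly n := by
  intro M
  induction M using Nat.strong_induction_on with
  | _ M IH =>
  have inner : ∀ K, ∀ σ : ℕ → ℕ, ∀ m, Good n σ → Mm n σ = M → m + 1 < n → σ (m+1) < σ m →
      (∀ i, i < m → σ i < σ (i+1)) →
      ((Finset.range n).filter (fun j => σ m < σ j)).card = K →
      Gp n σ = (MvPolynomial.X 0) ^ (adj (Dc σ) (List.range n)) * Npoly n := by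
    intro K
    induction K with
    | zero =>
      intro σ m hg hM hm hd hf hK
      have hmax : ∀ x, x < n → x ≠ m → σ x < σ m := by
        intro x hx hxm
        rw [Finset.card_eq_zero] at hK
        have h1 : x ∉ (Finset.range n).filter (fun j => σ m < σ j) := by rw [hK]; simp
        simp [hx] at h1
        rcases Nat.lt_or_eq_of_le h1 with h | h
        · exact h
        · exact absurd (hg.inj x m hx (by omega) h) hxm
      rw [Gp_rot hg hm hmax, d_rot hg hm hmax,
        IH (Mm n (rot n m σ)) (by rw [← hM]; exact M_rot hg hm hmax) _ (Good_rot hg (by omega)) rfl,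
        pow_add]
      ring
    | succ K ihK =>
      intro σ m hg hM hm hd hf hK
      obtain ⟨b, hb, hmin⟩ := Finset.exists_min_image
        ((Finset.range n).filter (fun j => σ m < σ j)) σ (by rw [← Finset.card_pos]; omega)
      simp only [Finset.mem_filter, Finset.mem_range] at hb hmin
      have hle : ∀ k, k ≤ m → σ (m - k) ≤ σ m := by
        intro k
        induction k with
        | zero => simp
        | succ k ih =>
          intro hk
          have h1 := ih (by omega)
          have h2 := hf (m - (k+1)) (by omega)
          have : m - (k+1) + 1 = m - k := by omega
          rw [this] at h2; omega
      have hab : m + 2 ≤ b := by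
        by_contra hcon
        by_cases h1 : b = m + 1
        · subst h1; omega
        · have := hle (m - b) (by omega)
          have e : m - (m - b) = b := by omega
          rw [e] at this; omega
      have hbet : ∀ x, x ≠ m → x ≠ b → σ x < σ m ∨ σ b < σ x := by
        intro x h1 h2
        by_cases hx : x < n
        · by_cases h3 : σ m < σ x
          · right
            have h4 := hmin x ⟨hx, h3⟩
            rcases Nat.lt_or_eq_of_le h4 with h | h
            · exact h
            · exact absurd (hg.inj b x hb.1 hx h).symm h2
          · left
            rcases Nat.lt_or_eq_of_le (not_lt.1 h3) with h | h
            · exact h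
            · exact absurd (hg.inj x m hx (by omega) h) h1
        · left; rw [hg.out x (by omega)]; exact hg.pos m (by omega)
      have hsw := swap_adj hab hb.2 hbet
      rw [Gp_swap hab hb.2 hbet]
      have e : adj (Dc σ) (List.range n) = adj (Dc (σ ∘ Equiv.swap m b)) (List.range n) := by
        rw [List.range_eq_range']
        exact adj_range'_congr _ _ (fun x => hsw x (x+1) (by omega)) _ _
      rw [e]
      apply ihK _ m (Good_swap hg (by omega) hb.1) _ hm
      · exact (hsw m (m+1) (by omega)).1 hd
      · intro i hi
        exact (hsw (i+1) i (by omega)).1 (hf i hi)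
      · have : (Finset.range n).filter (fun j => (σ ∘ Equiv.swap m b) m < (σ ∘ Equiv.swap m b) j)
            = ((Finset.range n).filter (fun j => σ m < σ j)).erase b := by
          ext x
          simp only [Finset.mem_filter, Finset.mem_erase, Finset.mem_range]
          by_cases x1 : x = m
          · subst x1; simp
          · by_cases x2 : x = b
            · subst x2; simp; omega
            · have := hbet x x1 x2
              simp [Equiv.swap_apply_of_ne_of_ne x1 x2, x2]
              omega
        rw [this, Finset.card_erase_of_mem (by simp [hb]), hK]
        rfl
      · rw [← hM]
        unfold Mm
        apply Finset.sum_congr rfl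
        intro i _
        simp only [hsw i (i+1) (by omega)]
  intro σ hg hM
  by_cases hinc : ∀ i, i + 1 < n → σ i < σ (i+1)
  · exact base_case hg hinc
  · have hex : ∃ i, i + 1 < n ∧ σ (i+1) ≤ σ i := by push Not at hinc; exact hinc
    have h1 := Nat.find_spec hex
    have h2 := fun k => Nat.find_min hex (m := k)
    generalize Nat.find hex = m at h1 h2
    refine inner _ σ m hg hM h1.1 ?_ ?_ rfl
    · rcases Nat.lt_or_eq_of_le h1.2 with h | h
      · exact h
      · have := hg.inj _ _ h1.1 (by omega) h; omega
    · intro i hi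
      have := h2 i hi
      omega

/-! the bijection -/
theorem surj_aux {n : ℕ} {σ : ℕ → ℕ} (hg : Good n σ) : ∀ (w : List ℕ) (i j : ℕ), j ≤ i → i ≤ n →
    (∀ x ∈ w, ∃ k, k < n ∧ σ k = x) →
    (∀ k, k < n → w.count (σ k) = (if i ≤ k then 1 else 0) + (if j ≤ k then 1 else 0)) →
    w.dedup = (List.range' j (n - j)).map σ → (∀ x y, [x, y, y, x].Sublist w → x = y) →
    ∃ s, Pth n i j s ∧ (fill i j s).map σ = w
  | [], i, j, hji, hin, hmem, hcount, hded, hav => by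
      have : ¬ (j < n) := by
        intro hj
        have := hcount j hj
        simp at this
      exact ⟨[], by simp only [Pth]; omega, by simp [fill]⟩
  | x :: w, i, j, hji, hin, hmem, hcount, hded, hav => by
      obtain ⟨l, hl, hlx⟩ := hmem x (by simp)
      have hmem' : ∀ x ∈ w, ∃ k, k < n ∧ σ k = x := fun y hy => hmem y (List.mem_cons_of_mem _ hy)
      have hav' : ∀ x y, [x, y, y, x].Sublist w → x = y :=
        fun u v h => hav u v (h.trans (List.sublist_cons_self _ _))
      have hcw : ∀ k, k < n → w.count (σ k) + (if k = l then 1 else 0) =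
          (if i ≤ k then 1 else 0) + (if j ≤ k then 1 else 0) := by
        intro k hk
        rw [← hcount k hk, List.count_cons, ← hlx]
        by_cases h : k = l
        · subst h; simp
        · have : σ l ≠ σ k := fun e => h (hg.inj _ _ hl hk e).symm
          simp [h, this]
      have hlj : j ≤ l := by
        by_contra hcon
        have := hcw l hl
        simp only [if_true] at this
        rw [if_neg (by omega), if_neg (by omega)] at this
        omega
      by_cases hli : l < i
      · -- a second copy
        have hc0 : w.count x = 0 := by
          have := hcw l hl
          simp only [if_true] at this
          rw [if_neg (by omega), if_pos (by omega), hlx] at this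
          omega
        have hx : x ∉ w := List.count_eq_zero.1 hc0
        rw [List.dedup_cons_of_notMem hx] at hded
        have e : n - j = (n - (j+1)) + 1 := by omega
        rw [e, List.range'_succ, List.map_cons, List.cons.injEq] at hded
        have hlj2 : l = j := hg.inj l j hl (by omega) (hlx.trans hded.1)
        obtain ⟨s, hs, hw⟩ := surj_aux hg w i (j+1) (by omega) hin hmem' (by
          intro k hk
          have := hcw k hk
          subst hlj2
          by_cases h1 : k = l
          · subst h1
            simp only [if_true] at this
            rw [if_neg (by omega), if_pos (by omega)] at this
            rw [if_neg (by omega), if_neg (by omega)]; omega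
          · simp only [h1, if_false] at this
            have e2 : l + 1 ≤ k ↔ l ≤ k := by omega
            simp only [e2]; simpa using this) hded.2 hav'
        exact ⟨false :: s, by simp only [Pth]; exact ⟨by omega, hs⟩, by simp only [fill, List.map_cons, hw, hded.1]⟩
      · -- a first copy
        have hc1 : w.count x = 1 := by
          have := hcw l hl
          simp only [if_true] at this
          rw [if_pos (by omega), if_pos (by omega), hlx] at this
          omega
        have hx : x ∈ w := by rw [← List.count_pos_iff]; omega
        rw [List.dedup_cons_of_mem hx] at hded
        have hl2 : l = i := by
          by_contra hne
          have hin' : i < n := by omega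
          have hc2 : w.count (σ i) = 2 := by
            have := hcw i hin'
            rw [if_neg (by omega), if_pos (by omega), if_pos (by omega)] at this
            omega
          have hxy : σ i ≠ x := by
            intro h; rw [← hlx] at h
            exact hne (hg.inj i l hin' hl h).symm
          obtain ⟨A, B, rfl⟩ := List.append_of_mem hx
          have hB : σ i ∉ B := by
            intro hB
            have s1 : [x, σ i].Sublist (A ++ x :: B).dedup := by
              have hxB : x ∉ B := by
                rw [← List.count_eq_zero]
                rw [List.count_append, List.count_cons_self] at hc1
                omega
              rw [List.dedup_append, List.dedup_cons_of_notMem hxB]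
              refine List.Sublist.trans ?_ (List.suffix_union_right _ _).sublist
              refine List.Sublist.cons_cons x ?_
              rw [List.singleton_sublist, List.mem_dedup]
              exact hB
            rw [hded] at s1
            have pw : ((List.range' j (n - j)).map σ).Pairwise
                (fun u v => ∃ p q, p < q ∧ q < n ∧ σ p = u ∧ σ q = v) := by
              rw [List.pairwise_map]
              have := (List.pairwise_lt_range' (s := j) (n := n - j))
              refine List.Pairwise.imp_of_mem ?_ this
              intro p q hp hq hpq
              rw [List.mem_range'_1] at hq
              exact ⟨p, q, hpq, by omega, rfl, rfl⟩
            have pw2 := pw.sublist s1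
            simp only [List.pairwise_cons, List.mem_singleton, forall_eq] at pw2
            obtain ⟨p, q, hpq, hq, h1, h2⟩ := pw2.1
            have := hg.inj p l (by omega) hl (h1.trans hlx.symm)
            have := hg.inj q i hq hin' h2
            omega
          have hA : 2 ≤ A.count (σ i) := by
            rw [List.count_append, List.count_cons_of_ne hxy.symm,
              List.count_eq_zero.2 hB] at hc2
            omega
          rw [← List.replicate_sublist_iff] at hA
          apply hxy
          symm
          apply hav
          refine List.Sublist.cons_cons x ?_
          exact List.Sublist.append (l₁ := [σ i, σ i]) (r₁ := [x]) hA
            (List.Sublist.cons_cons x (List.nil_sublist _))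
        obtain ⟨s, hs, hw⟩ := surj_aux hg w (i+1) j (by omega) (by omega) hmem' (by
          intro k hk
          have := hcw k hk
          subst hl2
          by_cases h1 : k = l
          · subst h1
            simp only [if_true] at this
            rw [if_pos (by omega), if_pos (by omega)] at this
            rw [if_neg (by omega), if_pos (by omega)]; omega
          · simp only [h1, if_false] at this
            have e2 : l + 1 ≤ k ↔ l ≤ k := by omega
            simp only [e2]; simpa using this) hded hav'
        exact ⟨true :: s, by simp only [Pth]; exact hs, by simp only [fill, List.map_cons, hw]; rw [← hl2, hlx]⟩

theorem count_baseWord (n k x : ℕ) :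
    (baseWord n k).count x = if 1 ≤ x ∧ x ≤ n then k else 0 := by
  induction n with
  | zero => simp [baseWord]; omega
  | succ n ih =>
    have : baseWord (n+1) k = baseWord n k ++ List.replicate k (n+1) := by
      simp [baseWord, List.range_succ]
    rw [this, List.count_append, ih, List.count_replicate]
    simp only [beq_iff_eq]
    split_ifs <;> omega

theorem mem_multiPerms (n k : ℕ) (w : List ℕ) :
    w ∈ multiPerms n k ↔ ∀ x, w.count x = if 1 ≤ x ∧ x ≤ n then k else 0 := by
  simp only [multiPerms, List.mem_toFinset, List.mem_permutations, List.perm_iff_count,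
    count_baseWord]

theorem sigma_facts (n : ℕ) (σ : List ℕ) (hσ : σ ∈ multiPerms n 1) :
    Good n (fun i => σ.getD i 0) ∧ σ = (List.range n).map (fun i => σ.getD i 0) := by
  have hc := (mem_multiPerms n 1 σ).1 hσ
  have hnd : σ.Nodup := by
    rw [List.nodup_iff_count_le_one]
    intro a; rw [hc a]; split_ifs <;> omega
  have hlen : σ.length = n := by
    simp only [multiPerms, List.mem_toFinset, List.mem_permutations] at hσ
    rw [hσ.length_eq]
    simp [baseWord]
  refine ⟨⟨?_, ?_, ?_⟩, ?_⟩
  · intro i hi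
    simp [List.getD_eq_default, hlen, hi]
  · intro i hi
    have hi' : i < σ.length := by omega
    have h1 := hc (σ[i])
    have h2 : 0 < σ.count σ[i] := List.count_pos_iff.2 (List.getElem_mem hi')
    simp only [List.getD_eq_getElem _ _ hi']
    split_ifs at h1 <;> omega
  · intro i j hi hj h
    simp only [List.getD_eq_getElem _ _ (show i < σ.length by omega),
      List.getD_eq_getElem _ _ (show j < σ.length by omega)] at h
    exact (hnd.getElem_inj_iff).1 h
  · apply List.ext_getElem
    · simp [hlen]
    · intro i h1 h2
      simp [h1]

theorem count_map_inj {n : ℕ} {σ : ℕ → ℕ} (hg : Good n σ) (w : List ℕ) (hw : ∀ x ∈ w, x < n)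
    (k : ℕ) (hk : k < n) : (w.map σ).count (σ k) = w.count k := by
  induction w with
  | nil => simp
  | cons x w ih =>
    rw [List.map_cons, List.count_cons, List.count_cons,
      ih (fun y hy => hw y (List.mem_cons_of_mem _ hy))]
    by_cases h : x = k
    · subst h; simp
    · have : σ x ≠ σ k := fun e => h (hg.inj _ _ (hw x (by simp)) hk e)
      simp [h, this]

theorem mem_map_inj {n : ℕ} {σ : ℕ → ℕ} (hg : Good n σ) (w : List ℕ) (hw : ∀ x ∈ w, x < n)
    (k : ℕ) (hk : k < n) : σ k ∈ w.map σ ↔ k ∈ w := by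
  rw [← List.count_pos_iff, count_map_inj hg w hw k hk, List.count_pos_iff]

theorem dedup_map_inj {n : ℕ} {σ : ℕ → ℕ} (hg : Good n σ) (w : List ℕ) (hw : ∀ x ∈ w, x < n) :
    (w.map σ).dedup = w.dedup.map σ := by
  induction w with
  | nil => simp
  | cons x w ih =>
    have hw' : ∀ y ∈ w, y < n := fun y hy => hw y (List.mem_cons_of_mem _ hy)
    have hm := mem_map_inj hg w hw' x (hw x (by simp))
    by_cases h : x ∈ w
    · rw [List.map_cons, List.dedup_cons_of_mem (hm.2 h), List.dedup_cons_of_mem h, ih hw']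
    · rw [List.map_cons, List.dedup_cons_of_notMem (fun e => h (hm.1 e)),
        List.dedup_cons_of_notMem h, ih hw', List.map_cons]

theorem map_inj' {n : ℕ} {σ : ℕ → ℕ} (hg : Good n σ) : ∀ (w w' : List ℕ), (∀ x ∈ w, x < n) →
    (∀ x ∈ w', x < n) → w.map σ = w'.map σ → w = w'
  | [], [], _, _, _ => rfl
  | [], _ :: _, _, _, h => by simp at h
  | _ :: _, [], _, _, h => by simp at h
  | x :: w, y :: w', h1, h2, h => by
     simp only [List.map_cons, List.cons.injEq] at h
     rw [hg.inj x y (h1 x (by simp)) (h2 y (by simp)) h.1,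
       map_inj' hg w w' (fun y hy => h1 y (List.mem_cons_of_mem _ hy))
         (fun y hy => h2 y (List.mem_cons_of_mem _ hy)) h.2]

theorem range_of_count {n : ℕ} {σ : List ℕ} {f : ℕ → ℕ} (hσ : σ ∈ multiPerms n 1)
    (he : σ = (List.range n).map f) (x : ℕ) : (1 ≤ x ∧ x ≤ n) ↔ ∃ k, k < n ∧ f k = x := by
  have hc := (mem_multiPerms n 1 σ).1 hσ x
  have : x ∈ σ ↔ ∃ k, k < n ∧ f k = x := by rw [he]; simp
  rw [← this, ← List.count_pos_iff, hc]
  split_ifs with h <;> simp [h]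

/-- Refined theorem: C_n^σ(t,u) = t^{des σ} · N_n(t,u) for every σ ∈ S_n. -/
theorem Cpoly_sigma_eq (n : ℕ) (σ : List ℕ) (hσ : σ ∈ multiPerms n 1) :
    (∑ π ∈ (nonnest n).filter (fun π => π.dedup = σ),
        (MvPolynomial.X 0 : MvPolynomial (Fin 2) ℚ) ^ des π * (MvPolynomial.X 1) ^ plat π)
      = (MvPolynomial.X 0) ^ des σ * Npoly n := by
  obtain ⟨hg, he⟩ := sigma_facts n σ hσ
  generalize (fun i => σ.getD i 0) = f at hg he
  have hrange := range_of_count hσ he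
  have hmain := main_ind n _ f hg rfl
  have hdes : des σ = adj (Dc f) (List.range n) := by
    rw [he, des_map]; rfl
  rw [hdes, ← hmain]
  symm
  unfold Gp
  refine Finset.sum_bij (fun D _ => (fill 0 0 D).map f) ?_ ?_ ?_ ?_
  · intro D hD
    rw [dyck_iff] at hD
    have hlt : ∀ x ∈ fill 0 0 D, x < n := fun x hx => ((mem_fill hD).1 hx).2
    rw [Finset.mem_filter, nonnest, Finset.mem_filter, mem_multiPerms, avoids_iff]
    refine ⟨⟨?_, ?_⟩, ?_⟩
    · intro x
      by_cases hx : 1 ≤ x ∧ x ≤ n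
      · rw [if_pos hx]
        obtain ⟨k, hk, rfl⟩ := (hrange x).1 hx
        rw [count_map_inj hg _ hlt k hk, count_fill k hD]
        simp [hk]
      · rw [if_neg hx, List.count_eq_zero]
        intro hmem
        rw [List.mem_map] at hmem
        obtain ⟨k, hk, rfl⟩ := hmem
        exact hx ((hrange _).2 ⟨k, hlt k hk, rfl⟩)
    · intro x y hs
      exfalso
      rw [List.sublist_map_iff] at hs
      obtain ⟨l', hl', hmap⟩ := hs
      have hmem : ∀ z ∈ l', z < n := fun z hz => hlt z (hl'.subset hz)
      have hlen : l'.length = 4 := by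
        have := congrArg List.length hmap
        simpa using this.symm
      match l', hlen, hmap, hl', hmem with
      | [p, q, r, s], _, hmap, hl', hmem =>
        simp only [List.map_cons, List.map_nil, List.cons.injEq, and_true] at hmap
        obtain ⟨h1, h2, h3, h4⟩ := hmap
        have e1 := hg.inj p s (hmem p (by simp)) (hmem s (by simp)) (h1.symm.trans h4)
        have e2 := hg.inj q r (hmem q (by simp)) (hmem r (by simp)) (h2.symm.trans h3)
        subst e1 e2
        exact avoid_fill hD hl'
    · rw [dedup_map_inj hg _ hlt, dedup_fill le_rfl hD, he, List.range_eq_range']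
      simp
  · intro D hD D' hD' h
    rw [dyck_iff] at hD hD'
    exact fill_inj hD hD' (map_inj' hg _ _ (fun x hx => ((mem_fill hD).1 hx).2)
      (fun x hx => ((mem_fill hD').1 hx).2) h)
  · intro w hw
    rw [Finset.mem_filter, nonnest, Finset.mem_filter, mem_multiPerms, avoids_iff] at hw
    obtain ⟨⟨hc, hav⟩, hded⟩ := hw
    obtain ⟨s, hs, hsw⟩ := surj_aux hg w 0 0 le_rfl (Nat.zero_le n) (by
        intro x hx
        rw [← hrange]
        by_contra hcon
        have := hc x
        rw [if_neg hcon, List.count_eq_zero] at this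
        exact this hx) (by
        intro k hk
        rw [hc, if_pos ((hrange _).2 ⟨k, hk, rfl⟩)]
        simp) (by
        rw [hded, he, List.range_eq_range']; simp) hav
    exact ⟨s, (dyck_iff n s).2 hs, hsw⟩
  · intro D hD
    rw [dyck_iff] at hD
    have hlt : ∀ x ∈ fill 0 0 D, x < n := fun x hx => ((mem_fill hD).1 hx).2
    rw [des_map, plat_map]
    congr 2
    apply adj_congr
    intro x hx y hy
    exact ⟨fun h => by rw [h], fun h => hg.inj _ _ (hlt y hy) (hlt x hx) h⟩
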